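/- Let N ≥ 1, γ > 0, z* ∈ ℝ, r* > 0, set X* = (z*, r*), and let Y_{1,0}, …, Y_{N,0} ∈ ℝ² have pairwise distinct r-components; set d₀ = (1/4)·min_{j≠k} |Y_{j,0,r} − Y_{k,0,r}| and fix h₀ ∈ (0, min(r*/240, 1/2)]. Then there exist T_X > 0, ε₀ ∈ (0, e^{−1}] and C > 0 such that for every ε ∈ (0, ε₀], writing L = |ln ε| and X_{i,0}^ε = X* + Y_{i,0}/√L: (i) there is a unique C¹ solution X^ε = (X₁^ε, …, X_N^ε) : [0, T_X] → (ℝ²)^N of dX_i/dt = (γ/(4π·X_{i,r}))·e_z + (γ/(2πL))·Σ_{j≠i} (X_i − X_j)^⊥/|X_i − X_j|² with X_i^ε(0) = X_{i,0}^ε; (ii) there is a unique C¹ solution Ỹ = (Ỹ₁, …, Ỹ_N) : [0, T_X] → (ℝ²)^N of dỸ_i/dt = (γ/(2π))·Σ_{j≠i} (Ỹ_i − Ỹ_j)^⊥/|Ỹ_i − Ỹ_j|² − (γ/(4π(r*)²))·Ỹ_{i,r}·e_z with Ỹ_i(0) = Y_{i,0}; (iii) setting X̃_i^ε(t) = X*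 + (γ/(4πr*))·t·e_z + Ỹ_i(t)/√L, for all t ∈ [0, T_X] and all i one has |X_{i,r}^ε(t) − X_{i,0,r}^ε| ≤ d₀/√L, |X_{i,z}^ε(t) − z*| ≤ h₀, |X̃_{i,r}^ε(t) − X_{i,0,r}^ε| ≤ d₀/√L, |X̃_{i,z}^ε(t) − z*| ≤ h₀, and |X_i^ε(t) − X̃_i^ε(t)| ≤ C/L. -/

import Mathlib

open Finset

/-- Counterclockwise rotation by `π/2`: for `a = (a_z, a_r)`, `a^⊥ = (−a_r, a_z)`.
Points of `ℝ²` are written with coordinate `0` the `z`-coordinate and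
coordinate `1` the `r`-coordinate. -/
noncomputable def perp (a : EuclideanSpace ℝ (Fin 2)) : EuclideanSpace ℝ (Fin 2) :=
  (WithLp.equiv 2 (Fin 2 → ℝ)).symm ![-(a 1), a 0]

/-- The unit vector `e_z = (1, 0)`. -/
noncomputable def ez : EuclideanSpace ℝ (Fin 2) :=
  (WithLp.equiv 2 (Fin 2 → ℝ)).symm ![1, 0]

/-- The right-hand side of the `ε`-dependent leapfrogging point system (`L = |ln ε|`):
`(γ/(4π·X_{i,r}))·e_z + (γ/(2πL))·Σ_{j≠i} (X_i − X_j)^⊥/|X_i − X_j|²`. -/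
noncomputable def epsRHS (N : ℕ) (γ L : ℝ)
    (X : Fin N → EuclideanSpace ℝ (Fin 2)) (i : Fin N) : EuclideanSpace ℝ (Fin 2) :=
  (γ/(4*Real.pi * X i 1)) • ez
    + (γ/(2*Real.pi*L)) • (∑ j ∈ univ.erase i, (‖X i - X j‖^2)⁻¹ • perp (X i - X j))

/-- The right-hand side of the limiting leapfrogging point system:
`(γ/(2π))·Σ_{j≠i} (Y_i − Y_j)^⊥/|Y_i − Y_j|² − (γ/(4π(r*)²))·Y_{i,r}·e_z`. -/
noncomputable def lfRHS (N : ℕ) (γ rstar : ℝ)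
    (q : Fin N → EuclideanSpace ℝ (Fin 2)) (i : Fin N) : EuclideanSpace ℝ (Fin 2) :=
  (γ/(2*Real.pi)) • (∑ j ∈ univ.erase i, (‖q i - q j‖^2)⁻¹ • perp (q i - q j))
    - (γ/(4*Real.pi*rstar^2) * q i 1) • ez

/-- `X` is a `C¹` solution on `[0, T]` of the `ε`-dependent leapfrogging point system
with initial datum `X0`, staying in the open half-plane and collisionless. -/
def IsEpsSol (N : ℕ) (γ L T : ℝ)
    (X0 : Fin N → EuclideanSpace ℝ (Fin 2))
    (X : ℝ → Fin N → EuclideanSpace ℝ (Fin 2)) : Prop :=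
  X 0 = X0 ∧
  (∀ t ∈ Set.Icc (0:ℝ) T, (∀ i, 0 < X t i 1) ∧ ∀ i j, i ≠ j → X t i ≠ X t j) ∧
  (∀ i, ∀ t ∈ Set.Icc (0:ℝ) T,
    HasDerivWithinAt (fun s => X s i) (epsRHS N γ L (X t) i) (Set.Icc 0 T) t)

/-- `Y` is a collisionless `C¹` solution on `[0, T]` of the limiting leapfrogging point
system with initial datum `Y0`. -/
def IsLimSol (N : ℕ) (γ rstar T : ℝ)
    (Y0 : Fin N → EuclideanSpace ℝ (Fin 2))
    (Y : ℝ → Fin N → EuclideanSpace ℝ (Fin 2)) : Prop :=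
  Y 0 = Y0 ∧
  (∀ t ∈ Set.Icc (0:ℝ) T, ∀ i j, i ≠ j → Y t i ≠ Y t j) ∧
  (∀ i, ∀ t ∈ Set.Icc (0:ℝ) T,
    HasDerivWithinAt (fun s => Y s i) (lfRHS N γ rstar (Y t) i) (Set.Icc 0 T) t)

open Set Filter Topology Metric in
/-- A time-independent Picard–Lindelöf theorem that also records that the solution stays in the
closed ball on which the vector field is controlled. -/
theorem exists_hasDerivWithinAt_forall_mem_closedBall {E : Type*} [NormedAddCommGroup E]
    [NormedSpace ℝ E] [CompleteSpace E] {f : E → E} {x₀ : E} {a M K : NNReal} {T : ℝ}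
    (hT : 0 ≤ T)
    (hl : LipschitzOnWith K f (closedBall x₀ a))
    (hb : ∀ x ∈ closedBall x₀ a, ‖f x‖ ≤ M) (hMT : M * T ≤ a) :
    ∃ α : ℝ → E, α 0 = x₀ ∧ (∀ t, α t ∈ closedBall x₀ a) ∧
      ∀ t ∈ Icc 0 T, HasDerivWithinAt α (f (α t)) (Icc 0 T) t := by
  have h0 : (0 : ℝ) ∈ Icc 0 T := ⟨le_rfl, hT⟩
  have hf : IsPicardLindelof (fun _ : ℝ => f) (⟨0, h0⟩ : Icc (0 : ℝ) T) x₀ a 0 M K := by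
    refine IsPicardLindelof.of_time_independent hb hl ?_
    simpa [hT] using hMT
  obtain ⟨α, hα⟩ := ODE.FunSpace.exists_isFixedPt_next hf (mem_closedBall_self le_rfl)
  refine ⟨α.compProj, ?_, fun t => α.compProj_mem_closedBall hf.mul_max_le, fun t ht => ?_⟩
  · have h1 : α.compProj 0 = α ⟨0, h0⟩ := ODE.FunSpace.compProj_of_mem h0
    rw [h1, ← hα, ODE.FunSpace.next_apply₀]
  · apply ODE.hasDerivWithinAt_picard_Icc h0 hf.continuousOn_uncurry
      α.continuous_compProj.continuousOn (fun _ ht' ↦ α.compProj_mem_closedBall hf.mul_max_le)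
      x₀ ht |>.congr_of_mem _ ht
    intro t' ht'
    nth_rw 1 [← hα]
    rw [ODE.FunSpace.compProj_of_mem ht', ODE.FunSpace.next_apply]

@[simp] theorem perp_apply_zero (a : EuclideanSpace ℝ (Fin 2)) : perp a 0 = -(a 1) := rfl

@[simp] theorem perp_apply_one (a : EuclideanSpace ℝ (Fin 2)) : perp a 1 = a 0 := rfl

@[simp] theorem ez_apply_zero : ez 0 = 1 := rfl

@[simp] theorem ez_apply_one : ez 1 = 0 := rfl

theorem perp_sub (a b : EuclideanSpace ℝ (Fin 2)) : perp (a - b) = perp a - perp b := by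
  ext i
  fin_cases i <;> simp
  ring

theorem perp_smul (c : ℝ) (a : EuclideanSpace ℝ (Fin 2)) : perp (c • a) = c • perp a := by
  ext i
  fin_cases i <;> simp

theorem norm_perp (a : EuclideanSpace ℝ (Fin 2)) : ‖perp a‖ = ‖a‖ := by
  simp [EuclideanSpace.norm_eq, Fin.sum_univ_two, add_comm]

theorem norm_ez : ‖ez‖ = 1 := by
  simp [EuclideanSpace.norm_eq, Fin.sum_univ_two]

theorem abs_apply_le_norm (a : EuclideanSpace ℝ (Fin 2)) (k : Fin 2) : |a k| ≤ ‖a‖ :=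
  PiLp.norm_apply_le a k

/-- The planar point-vortex kernel `a^⊥ / |a|²`. -/
noncomputable def vortexKernel (a : EuclideanSpace ℝ (Fin 2)) : EuclideanSpace ℝ (Fin 2) :=
  (‖a‖ ^ 2)⁻¹ • perp a

theorem norm_vortexKernel (a : EuclideanSpace ℝ (Fin 2)) : ‖vortexKernel a‖ = ‖a‖⁻¹ := by
  rw [vortexKernel, norm_smul, norm_perp, norm_inv, norm_pow, norm_norm]
  rcases eq_or_ne ‖a‖ 0 with h | h
  · simp [h]
  · field_simp

theorem vortexKernel_smul {c : ℝ} (hc : c ≠ 0) (a : EuclideanSpace ℝ (Fin 2)) :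
    vortexKernel (c • a) = c⁻¹ • vortexKernel a := by
  rw [vortexKernel, vortexKernel, perp_smul, smul_smul, smul_smul, norm_smul, mul_pow,
    Real.norm_eq_abs, sq_abs]
  congr 1
  field_simp

theorem norm_vortexKernel_sub_le {δ : ℝ} (hδ : 0 < δ) {a b : EuclideanSpace ℝ (Fin 2)}
    (ha : δ ≤ ‖a‖) (hb : δ ≤ ‖b‖) :
    ‖vortexKernel a - vortexKernel b‖ ≤ 1 / δ ^ 2 * ‖a - b‖ := by
  have ha0 : a ≠ 0 := norm_pos_iff.1 (hδ.trans_le ha)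
  have hb0 : b ≠ 0 := norm_pos_iff.1 (hδ.trans_le hb)
  have h := dist_div_norm_sq_smul ha0 hb0 1
  simp only [dist_eq_norm, one_div, inv_pow, one_pow] at h
  have h2 : vortexKernel a - vortexKernel b
      = perp ((‖a‖ ^ 2)⁻¹ • a - (‖b‖ ^ 2)⁻¹ • b) := by
    rw [perp_sub, perp_smul, perp_smul, vortexKernel, vortexKernel]
  rw [h2, norm_perp, h, ← one_div]
  gcongr
  rw [sq]
  gcongr

/-- The vector field of the leapfrogging system in the moving, rescaled frame; `σ = 1/√|ln ε|`
for the `ε`-dependent system and `σ = 0` for the limiting one. -/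
noncomputable def rescaledRHS (N : ℕ) (γ r σ : ℝ)
    (Z : Fin N → EuclideanSpace ℝ (Fin 2)) (i : Fin N) : EuclideanSpace ℝ (Fin 2) :=
  (γ / (2 * Real.pi)) • (∑ j ∈ univ.erase i, vortexKernel (Z i - Z j))
    - (γ / (4 * Real.pi) * (Z i 1 / (r * (r + σ * Z i 1)))) • ez

/-- Configurations with mutual distances at least `δ` and physical radii at least `δ`. -/
def separatedSet (N : ℕ) (r σ δ : ℝ) : Set (Fin N → EuclideanSpace ℝ (Fin 2)) :=
  {Z | (∀ i j, i ≠ j → δ ≤ ‖Z i - Z j‖) ∧ ∀ i, δ ≤ r + σ * Z i 1}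

/-- Solutions of the rescaled system on `[0, T]`. -/
def IsRescaledSol (N : ℕ) (γ r σ T : ℝ) (Y₀ : Fin N → EuclideanSpace ℝ (Fin 2))
    (Z : ℝ → Fin N → EuclideanSpace ℝ (Fin 2)) : Prop :=
  Z 0 = Y₀ ∧
  (∀ t ∈ Set.Icc (0 : ℝ) T, (∀ i, 0 < r + σ * Z t i 1) ∧ ∀ i j, i ≠ j → Z t i ≠ Z t j) ∧
  ∀ t ∈ Set.Icc (0 : ℝ) T,
    HasDerivWithinAt Z (rescaledRHS N γ r σ (Z t)) (Set.Icc 0 T) t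

/-- A Lipschitz constant of the rescaled vector field on `separatedSet N r σ δ`. -/
noncomputable def rescaledLip (N : ℕ) (γ δ : ℝ) : ℝ :=
  γ / (2 * Real.pi) * (N * (2 / δ ^ 2)) + γ / (4 * Real.pi) * (1 / δ ^ 2)

theorem rescaledLip_pos (N : ℕ) {γ δ : ℝ} (hγ : 0 < γ) (hδ : 0 < δ) : 0 < rescaledLip N γ δ := by
  have := Real.pi_pos
  unfold rescaledLip
  positivity

theorem lipschitzOnWith_rescaledRHS (N : ℕ) {γ r σ δ : ℝ} (hγ : 0 < γ) (hr : 0 < r)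
    (hδ : 0 < δ) :
    LipschitzOnWith (rescaledLip N γ δ).toNNReal (rescaledRHS N γ r σ) (separatedSet N r σ δ) := by
  have hπ := Real.pi_pos
  have hK := rescaledLip_pos N hγ hδ
  refine LipschitzOnWith.of_dist_le_mul fun Z hZ W hW => ?_
  rw [Real.coe_toNNReal _ hK.le, dist_eq_norm, dist_eq_norm,
    pi_norm_le_iff_of_nonneg (by positivity)]
  intro i
  have hnorm : ∀ k, ‖Z k - W k‖ ≤ ‖Z - W‖ := fun k => norm_le_pi_norm (Z - W) k
  have h1 : ‖∑ j ∈ univ.erase i, vortexKernel (Z i - Z j)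
      - ∑ j ∈ univ.erase i, vortexKernel (W i - W j)‖ ≤ N * (2 / δ ^ 2) * ‖Z - W‖ := by
    rw [← Finset.sum_sub_distrib]
    have hterm : ∀ j ∈ univ.erase i, ‖vortexKernel (Z i - Z j) - vortexKernel (W i - W j)‖
        ≤ 2 / δ ^ 2 * ‖Z - W‖ := by
      intro j hj
      have hij : i ≠ j := (Finset.ne_of_mem_erase hj).symm
      calc _ ≤ 1 / δ ^ 2 * ‖(Z i - Z j) - (W i - W j)‖ :=
            norm_vortexKernel_sub_le hδ (hZ.1 i j hij) (hW.1 i j hij)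
        _ ≤ 1 / δ ^ 2 * (‖Z - W‖ + ‖Z - W‖) := by
            gcongr
            rw [show (Z i - Z j) - (W i - W j) = (Z i - W i) - (Z j - W j) by abel]
            exact (norm_sub_le _ _).trans (add_le_add (hnorm i) (hnorm j))
        _ = _ := by ring
    calc _ ≤ ∑ j ∈ univ.erase i, 2 / δ ^ 2 * ‖Z - W‖ := norm_sum_le_of_le _ hterm
      _ = ((univ.erase i).card : ℝ) * (2 / δ ^ 2 * ‖Z - W‖) := by simp
      _ ≤ N * (2 / δ ^ 2 * ‖Z - W‖) := by
          gcongr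
          simp
      _ = _ := by ring
  have h2 : |Z i 1 / (r * (r + σ * Z i 1)) - W i 1 / (r * (r + σ * W i 1))|
      ≤ 1 / δ ^ 2 * ‖Z - W‖ := by
    have hz := hZ.2 i
    have hw := hW.2 i
    have hz0 : 0 < r + σ * Z i 1 := hδ.trans_le hz
    have hw0 : 0 < r + σ * W i 1 := hδ.trans_le hw
    have heq : Z i 1 / (r * (r + σ * Z i 1)) - W i 1 / (r * (r + σ * W i 1))
        = 1 / ((r + σ * Z i 1) * (r + σ * W i 1)) * (Z i 1 - W i 1) := by
      rw [div_sub_div _ _ (by positivity) (by positivity), one_div_mul_eq_div,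
        div_eq_div_iff (by positivity) (by positivity)]
      ring
    rw [heq, abs_mul, abs_of_pos (by positivity), sq]
    gcongr
    exact (abs_apply_le_norm (Z i - W i) 1).trans (hnorm i)
  have h3 : (rescaledRHS N γ r σ Z - rescaledRHS N γ r σ W) i
      = (γ / (2 * Real.pi)) • (∑ j ∈ univ.erase i, vortexKernel (Z i - Z j)
        - ∑ j ∈ univ.erase i, vortexKernel (W i - W j))
        - (γ / (4 * Real.pi) * (Z i 1 / (r * (r + σ * Z i 1))
          - W i 1 / (r * (r + σ * W i 1)))) • ez := by
    simp only [rescaledRHS, Pi.sub_apply]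
    module
  rw [h3]
  refine (norm_sub_le _ _).trans ?_
  rw [norm_smul, norm_smul, norm_ez, mul_one, Real.norm_eq_abs, Real.norm_eq_abs, abs_mul,
    abs_of_pos (by positivity : 0 < γ / (2 * Real.pi)),
    abs_of_pos (by positivity : 0 < γ / (4 * Real.pi)), rescaledLip, add_mul,
    mul_assoc (γ / (2 * Real.pi)), mul_assoc (γ / (4 * Real.pi))]
  gcongr

theorem norm_rescaledRHS_le (N : ℕ) {γ r σ δ R : ℝ} (hγ : 0 < γ) (hr : 0 < r) (hδ : 0 < δ)
    (hR : 0 ≤ R) {Z : Fin N → EuclideanSpace ℝ (Fin 2)} (hZ : Z ∈ separatedSet N r σ δ)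
    (hZR : ‖Z‖ ≤ R) :
    ‖rescaledRHS N γ r σ Z‖ ≤ γ / (2 * Real.pi) * (N * δ⁻¹) + γ / (4 * Real.pi) * (R / (r * δ)) := by
  have hπ := Real.pi_pos
  rw [pi_norm_le_iff_of_nonneg (by positivity)]
  intro i
  have h1 : ‖∑ j ∈ univ.erase i, vortexKernel (Z i - Z j)‖ ≤ N * δ⁻¹ := by
    calc _ ≤ ∑ j ∈ univ.erase i, δ⁻¹ := by
          refine norm_sum_le_of_le _ fun j hj => ?_
          rw [norm_vortexKernel]
          gcongr
          exact hZ.1 i j (Finset.ne_of_mem_erase hj).symm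
      _ = ((univ.erase i).card : ℝ) * δ⁻¹ := by simp
      _ ≤ _ := by
          gcongr
          simp
  have h2 : |Z i 1 / (r * (r + σ * Z i 1))| ≤ R / (r * δ) := by
    have hz := hZ.2 i
    have hz0 : 0 < r + σ * Z i 1 := hδ.trans_le hz
    rw [abs_div, abs_of_pos (by positivity : 0 < r * (r + σ * Z i 1))]
    gcongr
    exact (abs_apply_le_norm _ _).trans ((norm_le_pi_norm Z i).trans hZR)
  refine (norm_sub_le _ _).trans ?_
  rw [norm_smul, norm_smul, norm_ez, mul_one, Real.norm_eq_abs, Real.norm_eq_abs, abs_mul,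
    abs_of_pos (by positivity : 0 < γ / (2 * Real.pi)),
    abs_of_pos (by positivity : 0 < γ / (4 * Real.pi))]
  gcongr

theorem norm_rescaledRHS_sub_zero_le (N : ℕ) {γ r σ δ R : ℝ} (hγ : 0 < γ) (hr : 0 < r)
    (hδ : 0 < δ) (hσ : 0 ≤ σ) {Z : Fin N → EuclideanSpace ℝ (Fin 2)}
    (hZ : Z ∈ separatedSet N r σ δ) (hZR : ‖Z‖ ≤ R) :
    ‖rescaledRHS N γ r σ Z - rescaledRHS N γ r 0 Z‖
      ≤ γ / (4 * Real.pi) * (R ^ 2 / (r ^ 2 * δ)) * σ := by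
  have hπ := Real.pi_pos
  rw [pi_norm_le_iff_of_nonneg (by positivity)]
  intro i
  have hz := hZ.2 i
  have hz0 : 0 < r + σ * Z i 1 := hδ.trans_le hz
  have h3 : (rescaledRHS N γ r σ Z - rescaledRHS N γ r 0 Z) i
      = (γ / (4 * Real.pi) * ((Z i 1) ^ 2 / (r ^ 2 * (r + σ * Z i 1))) * σ) • ez := by
    have : γ / (4 * Real.pi) * ((Z i 1) ^ 2 / (r ^ 2 * (r + σ * Z i 1))) * σ
      = γ / (4 * Real.pi) * (Z i 1 / (r * (r + 0 * Z i 1)))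
        - γ / (4 * Real.pi) * (Z i 1 / (r * (r + σ * Z i 1))) := by
      rw [zero_mul, add_zero]
      rw [← mul_sub, mul_assoc]
      congr 1
      rw [div_sub_div _ _ (by positivity) (by positivity), div_mul_eq_mul_div,
        div_eq_div_iff (by positivity) (by positivity)]
      ring
    rw [this]
    simp only [rescaledRHS, Pi.sub_apply]
    module
  rw [h3, norm_smul, norm_ez, mul_one, Real.norm_eq_abs, abs_of_nonneg (by positivity)]
  have : (Z i 1) ^ 2 ≤ R ^ 2 :=
    sq_le_sq' (abs_le.1 ((abs_apply_le_norm _ _).trans ((norm_le_pi_norm Z i).trans hZR))).1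
      (abs_le.1 ((abs_apply_le_norm _ _).trans ((norm_le_pi_norm Z i).trans hZR))).2
  gcongr

theorem HasDerivWithinAt.Ici_of_Icc {E : Type*} [NormedAddCommGroup E] [NormedSpace ℝ E]
    {f : ℝ → E} {f' : E} {a b t : ℝ} (h : HasDerivWithinAt f f' (Set.Icc a b) t)
    (ht : t ∈ Set.Ico a b) : HasDerivWithinAt f f' (Set.Ici t) t :=
  h.mono_of_mem_nhdsWithin (Icc_mem_nhdsGE_of_mem ht)

open Filter Topology in
theorem eventually_forall_le_of_continuousOn {f : ℝ → ℝ} {T : ℝ}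
    (hf : ContinuousOn f (Set.Icc 0 T)) (hpos : ∀ t ∈ Set.Icc 0 T, 0 < f t) :
    ∀ᶠ δ in 𝓝[>] (0 : ℝ), ∀ t ∈ Set.Icc 0 T, δ ≤ f t := by
  rcases (Set.Icc (0 : ℝ) T).eq_empty_or_nonempty with h | h
  · simp [h]
  · obtain ⟨t₀, ht₀, hmin⟩ := isCompact_Icc.exists_isMinOn h hf
    filter_upwards [nhdsWithin_le_nhds (Iio_mem_nhds (hpos t₀ ht₀))] with δ hδ t ht
    exact (le_of_lt hδ).trans (hmin ht)

namespace IsRescaledSol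

variable {N : ℕ} {γ r σ T : ℝ} {Y₀ : Fin N → EuclideanSpace ℝ (Fin 2)}
  {Z W : ℝ → Fin N → EuclideanSpace ℝ (Fin 2)}

theorem continuousOn (hZ : IsRescaledSol N γ r σ T Y₀ Z) : ContinuousOn Z (Set.Icc 0 T) :=
  fun t ht => (hZ.2.2 t ht).continuousWithinAt

open Filter Topology in
theorem eventually_mem_separatedSet (hZ : IsRescaledSol N γ r σ T Y₀ Z) :
    ∀ᶠ δ in 𝓝[>] (0 : ℝ), ∀ t ∈ Set.Icc 0 T, Z t ∈ separatedSet N r σ δ := by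
  have hc : ∀ i, ContinuousOn (fun t => Z t i) (Set.Icc 0 T) :=
    fun i => (continuous_apply i).comp_continuousOn hZ.continuousOn
  have h1 : ∀ᶠ δ in 𝓝[>] (0 : ℝ), ∀ i j, i ≠ j → ∀ t ∈ Set.Icc 0 T, δ ≤ ‖Z t i - Z t j‖ := by
    refine eventually_all.2 fun i => eventually_all.2 fun j => ?_
    by_cases hij : i = j
    · simp [hij]
    · filter_upwards [eventually_forall_le_of_continuousOn ((hc i).sub (hc j)).norm
        fun t ht => norm_pos_iff.2 (sub_ne_zero.2 ((hZ.2.1 t ht).2 i j hij))] with δ hδ _ using hδ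
  have h2 : ∀ᶠ δ in 𝓝[>] (0 : ℝ), ∀ i, ∀ t ∈ Set.Icc 0 T, δ ≤ r + σ * Z t i 1 := by
    refine eventually_all.2 fun i => eventually_forall_le_of_continuousOn ?_
      fun t ht => (hZ.2.1 t ht).1 i
    have : Continuous fun a : EuclideanSpace ℝ (Fin 2) => r + σ * a 1 := by fun_prop
    exact this.comp_continuousOn (hc i)
  filter_upwards [h1, h2] with δ h1 h2 t ht
  exact ⟨fun i j hij => h1 i j hij t ht, fun i => h2 i t ht⟩

theorem eqOn (hγ : 0 < γ) (hr : 0 < r) (hZ : IsRescaledSol N γ r σ T Y₀ Z)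
    (hW : IsRescaledSol N γ r σ T Y₀ W) : Set.EqOn Z W (Set.Icc 0 T) := by
  obtain ⟨δ, ⟨h1, h2⟩, hδ⟩ := ((hZ.eventually_mem_separatedSet.and
    hW.eventually_mem_separatedSet).and self_mem_nhdsWithin).exists
  exact ODE_solution_unique_of_mem_Icc_right
    (fun t _ => lipschitzOnWith_rescaledRHS N hγ hr (σ := σ) hδ)
    hZ.continuousOn
    (fun t ht => (hZ.2.2 t (Set.Ico_subset_Icc_self ht)).Ici_of_Icc ht)
    (fun t ht => h1 t (Set.Ico_subset_Icc_self ht)) hW.continuousOn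
    (fun t ht => (hW.2.2 t (Set.Ico_subset_Icc_self ht)).Ici_of_Icc ht)
    (fun t ht => h2 t (Set.Ico_subset_Icc_self ht)) (hZ.1.trans hW.1.symm)

theorem norm_sub_le (hγ : 0 < γ) (hr : 0 < r) (hσ : 0 ≤ σ) {δ R : ℝ} (hδ : 0 < δ)
    (hZ : IsRescaledSol N γ r σ T Y₀ Z) (hW : IsRescaledSol N γ r 0 T Y₀ W)
    (hZs : ∀ t, Z t ∈ separatedSet N r σ δ) (hZs' : ∀ t, Z t ∈ separatedSet N r 0 δ)
    (hWs : ∀ t, W t ∈ separatedSet N r 0 δ) (hZR : ∀ t, ‖Z t‖ ≤ R) {t : ℝ}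
    (ht : t ∈ Set.Icc 0 T) :
    ‖Z t - W t‖ ≤ γ / (4 * Real.pi) * (R ^ 2 / (r ^ 2 * δ)) / rescaledLip N γ δ
      * Real.exp (rescaledLip N γ δ * T) * σ := by
  have hπ := Real.pi_pos
  have hK := rescaledLip_pos N hγ hδ
  have h := dist_le_of_approx_trajectories_ODE_of_mem (δ := 0) (εg := 0)
    (fun t _ => lipschitzOnWith_rescaledRHS N hγ hr (σ := 0) hδ)
    hZ.continuousOn
    (fun t ht => (hZ.2.2 t (Set.Ico_subset_Icc_self ht)).Ici_of_Icc ht)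
    (fun t _ => (dist_eq_norm _ _).trans_le
      (norm_rescaledRHS_sub_zero_le N hγ hr hδ hσ (hZs t) (hZR t)))
    (fun t _ => hZs' t) hW.continuousOn
    (fun t ht => (hW.2.2 t (Set.Ico_subset_Icc_self ht)).Ici_of_Icc ht)
    (fun t _ => (dist_self _).le) (fun t _ => hWs t)
    (by rw [hZ.1, hW.1, dist_self]) t ht
  rw [dist_eq_norm, Real.coe_toNNReal _ hK.le, gronwallBound_of_K_ne_0 hK.ne', sub_zero] at h
  refine h.trans ?_
  simp only [zero_mul, zero_add, add_zero]
  have hexp : Real.exp (rescaledLip N γ δ * t) - 1 ≤ Real.exp (rescaledLip N γ δ * T) := by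
    have : Real.exp (rescaledLip N γ δ * t) ≤ Real.exp (rescaledLip N γ δ * T) := by
      gcongr
      exact ht.2
    linarith
  calc _ ≤ γ / (4 * Real.pi) * (R ^ 2 / (r ^ 2 * δ)) * σ / rescaledLip N γ δ
        * Real.exp (rescaledLip N γ δ * T) := by gcongr
    _ = _ := by ring

end IsRescaledSol

theorem closedBall_subset_separatedSet {N : ℕ} {r σ d : ℝ}
    {Y₀ : Fin N → EuclideanSpace ℝ (Fin 2)}
    (hY₀ : ∀ i j, i ≠ j → 4 * d ≤ |Y₀ i 1 - Y₀ j 1|) (hσ : 0 ≤ σ)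
    (hσR : σ * (‖Y₀‖ + d) ≤ r / 2) :
    Metric.closedBall Y₀ d ⊆ separatedSet N r σ (min (2 * d) (r / 2)) := by
  intro Z hZ
  have hZn : ‖Z - Y₀‖ ≤ d := by simpa [dist_eq_norm] using hZ
  have hk : ∀ i, |Z i 1 - Y₀ i 1| ≤ d := fun i =>
    (abs_apply_le_norm (Z i - Y₀ i) 1).trans ((norm_le_pi_norm (Z - Y₀) i).trans hZn)
  refine ⟨fun i j hij => (min_le_left _ _).trans ?_, fun i => (min_le_right _ _).trans ?_⟩
  · have h1 : |Z i 1 - Z j 1| ≤ ‖Z i - Z j‖ := abs_apply_le_norm (Z i - Z j) 1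
    have h2 : |Y₀ i 1 - Y₀ j 1| ≤ |Y₀ i 1 - Z i 1| + |Z i 1 - Z j 1| + |Z j 1 - Y₀ j 1| := by
      refine (abs_sub_le _ (Z j 1) _).trans ?_
      gcongr
      exact abs_sub_le _ _ _
    have h3 := hk i
    rw [abs_sub_comm] at h3
    linarith [hY₀ i j hij, hk j]
  · have h1 : |Z i 1| ≤ ‖Y₀‖ + d :=
      (abs_apply_le_norm (Z i) 1).trans ((norm_le_pi_norm Z i).trans
        ((norm_le_norm_add_norm_sub' Z Y₀).trans (by gcongr)))
    have h2 : σ * |Z i 1| ≤ r / 2 := (mul_le_mul_of_nonneg_left h1 hσ).trans hσR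
    have h3 : σ * -|Z i 1| ≤ σ * Z i 1 := mul_le_mul_of_nonneg_left (neg_abs_le _) hσ
    linarith

theorem exists_isRescaledSol {N : ℕ} {γ r σ d T : ℝ} {Y₀ : Fin N → EuclideanSpace ℝ (Fin 2)}
    (hγ : 0 < γ) (hr : 0 < r) (hd : 0 < d) (hT : 0 ≤ T)
    (hY₀ : ∀ i j, i ≠ j → 4 * d ≤ |Y₀ i 1 - Y₀ j 1|) (hσ : 0 ≤ σ)
    (hσR : σ * (‖Y₀‖ + d) ≤ r / 2)
    (hMT : (γ / (2 * Real.pi) * (N * (min (2 * d) (r / 2))⁻¹)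
      + γ / (4 * Real.pi) * ((‖Y₀‖ + d) / (r * min (2 * d) (r / 2)))) * T ≤ d) :
    ∃ Z, IsRescaledSol N γ r σ T Y₀ Z ∧ ∀ t, Z t ∈ Metric.closedBall Y₀ d := by
  have hπ := Real.pi_pos
  have hδ : 0 < min (2 * d) (r / 2) := by positivity
  have hsub := closedBall_subset_separatedSet hY₀ hσ hσR
  obtain ⟨Z, h0, hmem, hder⟩ := exists_hasDerivWithinAt_forall_mem_closedBall
    (a := ⟨d, hd.le⟩) (M := ⟨_, by positivity⟩) hT
    ((lipschitzOnWith_rescaledRHS N hγ hr hδ).mono hsub)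
    (fun x hx => norm_rescaledRHS_le N hγ hr hδ (by positivity) (hsub hx)
      ((norm_le_norm_add_norm_sub' x Y₀).trans (by gcongr; rwa [Metric.mem_closedBall, dist_eq_norm] at hx))) hMT
  refine ⟨Z, ⟨h0, fun t _ => ⟨fun i => hδ.trans_le ((hsub (hmem t)).2 i), fun i j hij h => ?_⟩,
    hder⟩, hmem⟩
  have := (hsub (hmem t)).1 i j hij
  rw [h, sub_self, norm_zero] at this
  linarith

theorem lfRHS_eq_rescaledRHS (N : ℕ) (γ : ℝ) {r : ℝ} (hr : 0 < r) :
    lfRHS N γ r = rescaledRHS N γ r 0 := by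
  funext q i
  simp only [lfRHS, rescaledRHS, vortexKernel]
  congr 2
  have := Real.pi_pos
  rw [zero_mul, add_zero]
  field_simp

theorem isLimSol_iff_isRescaledSol {N : ℕ} {γ r T : ℝ} (hr : 0 < r)
    {Y₀ : Fin N → EuclideanSpace ℝ (Fin 2)} {Y : ℝ → Fin N → EuclideanSpace ℝ (Fin 2)} :
    IsLimSol N γ r T Y₀ Y ↔ IsRescaledSol N γ r 0 T Y₀ Y := by
  simp only [IsLimSol, IsRescaledSol, lfRHS_eq_rescaledRHS N γ hr, hasDerivWithinAt_pi, zero_mul,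
    add_zero, hr, implies_true, true_and]
  refine and_congr_right fun _ => and_congr_right fun _ => ?_
  exact ⟨fun h t ht i => h i t ht, fun h i t ht => h t ht i⟩

theorem epsRHS_eq_rescaledRHS {N : ℕ} {γ r L σ : ℝ} (hr : 0 < r) (hσ : 0 < σ)
    (hL : σ ^ 2 = L⁻¹) {p : EuclideanSpace ℝ (Fin 2)} (hp : p 1 = r) (s : ℝ)
    (Z : Fin N → EuclideanSpace ℝ (Fin 2)) (i : Fin N) (hZ : 0 < r + σ * Z i 1) :
    epsRHS N γ L (fun i => p + s • ez + σ • Z i) i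
      = (γ / (4 * Real.pi * r)) • ez + σ • rescaledRHS N γ r σ Z i := by
  have hπ := Real.pi_pos
  have hsum : ∑ j ∈ univ.erase i, (‖(p + s • ez + σ • Z i) - (p + s • ez + σ • Z j)‖ ^ 2)⁻¹ •
      perp ((p + s • ez + σ • Z i) - (p + s • ez + σ • Z j))
      = σ⁻¹ • ∑ j ∈ univ.erase i, vortexKernel (Z i - Z j) := by
    rw [Finset.smul_sum]
    refine Finset.sum_congr rfl fun j _ => ?_
    rw [add_sub_add_left_eq_sub, ← smul_sub, ← vortexKernel_smul hσ.ne']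
    rfl
  have hcoord : (p + s • ez + σ • Z i) 1 = r + σ * Z i 1 := by simp [hp]
  have h1 : γ / (2 * Real.pi * L) = σ ^ 2 * (γ / (2 * Real.pi)) := by
    rw [hL, div_mul_eq_div_div, div_eq_inv_mul]
  have h2 : γ / (4 * Real.pi * (r + σ * Z i 1)) = γ / (4 * Real.pi * r)
      - σ * (γ / (4 * Real.pi) * (Z i 1 / (r * (r + σ * Z i 1)))) := by
    field_simp
    ring
  simp only [epsRHS, rescaledRHS]
  rw [hsum, hcoord, h1, h2, smul_smul, smul_sub, smul_smul, smul_smul,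
    show σ ^ 2 * (γ / (2 * Real.pi)) * σ⁻¹ = σ * (γ / (2 * Real.pi)) by field_simp]
  module

theorem isEpsSol_iff_isRescaledSol {N : ℕ} {γ r L σ T : ℝ} (hr : 0 < r) (hσ : 0 < σ)
    (hL : σ ^ 2 = L⁻¹) {p : EuclideanSpace ℝ (Fin 2)} (hp : p 1 = r)
    {Y₀ : Fin N → EuclideanSpace ℝ (Fin 2)} {Z : ℝ → Fin N → EuclideanSpace ℝ (Fin 2)} :
    IsEpsSol N γ L T (fun i => p + σ • Y₀ i)
        (fun t i => p + (γ / (4 * Real.pi * r) * t) • ez + σ • Z t i)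
      ↔ IsRescaledSol N γ r σ T Y₀ Z := by
  have hcoord : ∀ (s : ℝ) (a : EuclideanSpace ℝ (Fin 2)),
      (p + s • ez + σ • a) 1 = r + σ * a 1 := fun s a => by simp [hp]
  have hinj : ∀ a b : EuclideanSpace ℝ (Fin 2), σ • a = σ • b ↔ a = b :=
    fun a b => (smul_right_injective _ hσ.ne').eq_iff
  simp only [IsEpsSol, IsRescaledSol]
  refine and_congr ?_ ?_
  · simp only [mul_zero, zero_smul, add_zero, funext_iff, add_right_inj, hinj]
  simp only [hcoord, ne_eq, add_right_inj, hinj]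
  refine and_congr_right fun hpos => ?_
  rw [forall_comm]
  refine forall_congr' fun t => ?_
  rw [forall_comm]
  refine forall_congr' fun ht => ?_
  rw [hasDerivWithinAt_pi]
  refine forall_congr' fun i => ?_
  rw [epsRHS_eq_rescaledRHS hr hσ hL hp _ _ _ ((hpos t ht).1 i)]
  have hbase : HasDerivWithinAt (fun s : ℝ => p + (γ / (4 * Real.pi * r) * s) • ez)
      ((γ / (4 * Real.pi * r)) • ez) (Set.Icc 0 T) t := by
    have h := (((hasDerivWithinAt_id t (Set.Icc 0 T)).const_mul
      (γ / (4 * Real.pi * r))).smul_const ez).const_add p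
    simpa using h
  refine ⟨fun h => ?_, fun h => hbase.add (h.const_smul σ)⟩
  have h' := (h.sub hbase).const_smul σ⁻¹
  have hf : (σ⁻¹ • ((fun s => p + (γ / (4 * Real.pi * r) * s) • ez + σ • Z s i)
      - fun s => p + (γ / (4 * Real.pi * r) * s) • ez)) = fun s => Z s i := by
    funext s
    simp [smul_smul, hσ.ne']
  rwa [hf, add_sub_cancel_left, smul_smul, inv_mul_cancel₀ hσ.ne', one_smul] at h'

theorem inv_sqrt_mul_le {A h L : ℝ} (hA : 0 ≤ A) (hh : 0 < h) (hL : (A / h) ^ 2 < L) :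
    (Real.sqrt L)⁻¹ * A ≤ h := by
  have h1 : A / h < Real.sqrt L := Real.lt_sqrt_of_sq_lt hL
  have h2 : 0 < Real.sqrt L := (by positivity : 0 ≤ A / h).trans_lt h1
  rw [div_lt_iff₀ hh] at h1
  rw [inv_mul_le_iff₀ h2]
  exact h1.le

/-- Well-posedness of the `ε`-dependent and limiting leapfrogging point systems on a
common small time interval `[0, T_X]`, confinement of both families of trajectories in
the rectangles `|r − X_{i,0,r}^ε| ≤ d₀/√L`, `|z − z*| ≤ h₀`, and closeness
`|X_i^ε(t) − X̃_i^ε(t)| ≤ C/L`, where `L = |ln ε|`,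
`X_{i,0}^ε = X* + Y_{i,0}/√L` and `X̃_i^ε(t) = X* + (γ/(4πr*))·t·e_z + Ỹ_i(t)/√L`. -/
theorem stmt_15 (N : ℕ) (hN : 1 ≤ N) (γ zstar rstar : ℝ) (hγ : 0 < γ) (hr : 0 < rstar)
    (Y₀ : Fin N → EuclideanSpace ℝ (Fin 2))
    (hY₀ : ∀ i j, i ≠ j → Y₀ i 1 ≠ Y₀ j 1)
    (d₀ : ℝ)
    (hd₀ : d₀ = (1/4) * sInf {d : ℝ | ∃ i j : Fin N, i ≠ j ∧ d = |Y₀ i 1 - Y₀ j 1|})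
    (hd₀pos : 0 < d₀)
    (h₀ : ℝ) (hh₀ : h₀ ∈ Set.Ioc (0:ℝ) (min (rstar/240) (1/2))) :
    ∃ TX > (0:ℝ), ∃ ε₀ ∈ Set.Ioc (0:ℝ) (Real.exp (-1)), ∃ C > (0:ℝ),
      ∀ ε ∈ Set.Ioc (0:ℝ) ε₀,
        let L := |Real.log ε|
        let Xstar : EuclideanSpace ℝ (Fin 2) :=
          (WithLp.equiv 2 (Fin 2 → ℝ)).symm ![zstar, rstar]
        let X₀ : Fin N → EuclideanSpace ℝ (Fin 2) :=
          fun i => Xstar + (Real.sqrt L)⁻¹ • Y₀ i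
        ∃ X Ytl : ℝ → Fin N → EuclideanSpace ℝ (Fin 2),
          -- (i) existence and uniqueness for the ε-dependent system on [0, TX]
          (IsEpsSol N γ L TX X₀ X ∧
            ∀ X', IsEpsSol N γ L TX X₀ X' → ∀ t ∈ Set.Icc (0:ℝ) TX, X' t = X t) ∧
          -- (ii) existence and uniqueness for the limiting system on [0, TX]
          (IsLimSol N γ rstar TX Y₀ Ytl ∧
            ∀ Y', IsLimSol N γ rstar TX Y₀ Y' → ∀ t ∈ Set.Icc (0:ℝ) TX, Y' t = Ytl t) ∧
          -- (iii) confinement and closeness of the two trajectories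
          (∀ t ∈ Set.Icc (0:ℝ) TX, ∀ i,
            let Xtl : EuclideanSpace ℝ (Fin 2) :=
              Xstar + (γ/(4*Real.pi*rstar) * t) • ez + (Real.sqrt L)⁻¹ • Ytl t i
            |X t i 1 - X₀ i 1| ≤ d₀ / Real.sqrt L ∧
            |X t i 0 - zstar| ≤ h₀ ∧
            |Xtl 1 - X₀ i 1| ≤ d₀ / Real.sqrt L ∧
            |Xtl 0 - zstar| ≤ h₀ ∧
            ‖X t i - Xtl‖ ≤ C / L) := by
  have hπ := Real.pi_pos
  obtain ⟨hh₀pos, hh₀le⟩ := hh₀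
  have hh₀r : h₀ ≤ rstar / 240 := hh₀le.trans (min_le_left _ _)
  have hsep : ∀ i j, i ≠ j → 4 * d₀ ≤ |Y₀ i 1 - Y₀ j 1| := by
    intro i j hij
    have hbdd : BddBelow {d : ℝ | ∃ i j : Fin N, i ≠ j ∧ d = |Y₀ i 1 - Y₀ j 1|} :=
      ⟨0, by rintro _ ⟨i, j, _, rfl⟩; exact abs_nonneg _⟩
    linarith [csInf_le hbdd ⟨i, j, hij, rfl⟩]
  have hNpos : (0 : ℝ) < N := by exact_mod_cast hN
  set δ := min (2 * d₀) (rstar / 2)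
  have hδ : 0 < δ := by positivity
  set R := ‖Y₀‖ + d₀
  have hR : 0 < R := by positivity
  set M := γ / (2 * Real.pi) * (N * δ⁻¹) + γ / (4 * Real.pi) * (R / (rstar * δ))
  have hM : 0 < M := by positivity
  set c := γ / (4 * Real.pi * rstar)
  have hc : 0 < c := by positivity
  set T := min (d₀ / M) (h₀ / 2 / c)
  have hT : 0 < T := by positivity
  have hMT : M * T ≤ d₀ :=
    (mul_le_mul_of_nonneg_left (min_le_left _ _) hM.le).trans_eq (mul_div_cancel₀ _ hM.ne')
  have hcT : ∀ t ∈ Set.Icc 0 T, |c * t| ≤ h₀ / 2 := by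
    intro t ht
    rw [abs_of_nonneg (mul_nonneg hc.le ht.1)]
    exact (mul_le_mul_of_nonneg_left (ht.2.trans (min_le_right _ _)) hc.le).trans_eq
      (mul_div_cancel₀ _ hc.ne')
  have hKpos := rescaledLip_pos N hγ hδ
  set C := γ / (4 * Real.pi) * (R ^ 2 / (rstar ^ 2 * δ)) / rescaledLip N γ δ
      * Real.exp (rescaledLip N γ δ * T)
  have hC : 0 < C := by positivity
  refine ⟨T, hT, Real.exp (-(1 + (R / (h₀ / 2)) ^ 2)), ⟨Real.exp_pos _, ?_⟩, C, hC, ?_⟩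
  · gcongr
    linarith [sq_nonneg (R / (h₀ / 2))]
  intro ε ⟨hε, hεle⟩ L Xstar X₀
  have hL : 1 + (R / (h₀ / 2)) ^ 2 ≤ L := by
    have h := Real.log_le_log hε hεle
    rw [Real.log_exp] at h
    exact (le_neg_of_le_neg h).trans (neg_le_abs _)
  have hLpos : 0 < L := by linarith [sq_nonneg (R / (h₀ / 2))]
  have hσ : 0 < (Real.sqrt L)⁻¹ := inv_pos.2 (Real.sqrt_pos.2 hLpos)
  have hσL : (Real.sqrt L)⁻¹ ^ 2 = L⁻¹ := by rw [inv_pow, Real.sq_sqrt hLpos.le]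
  have hσh : (Real.sqrt L)⁻¹ * R ≤ h₀ / 2 := inv_sqrt_mul_le hR.le (by positivity) (by linarith)
  have hdiv : ∀ x : ℝ, x / Real.sqrt L = (Real.sqrt L)⁻¹ * x := fun x => div_eq_inv_mul _ _
  simp only [hdiv]
  have hX₀ : X₀ = fun i => Xstar + (Real.sqrt L)⁻¹ • Y₀ i := rfl
  clear_value L X₀
  subst hX₀
  generalize (Real.sqrt L)⁻¹ = σ at *
  have hσr : σ * R ≤ rstar / 2 := by linarith
  have hp : Xstar 1 = rstar := rfl
  have hp0 : Xstar 0 = zstar := rfl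
  obtain ⟨Z, hZ, hZmem⟩ := exists_isRescaledSol hγ hr hd₀pos hT.le hsep hσ.le hσr hMT
  obtain ⟨Y, hY, hYmem⟩ := exists_isRescaledSol (σ := 0) hγ hr hd₀pos hT.le hsep le_rfl
    (by rw [zero_mul]; positivity) hMT
  have hsubσ := closedBall_subset_separatedSet hsep hσ.le hσr
  have hsub0 := closedBall_subset_separatedSet (r := rstar) (σ := 0) hsep le_rfl
    (by rw [zero_mul]; positivity)
  have hball : ∀ W ∈ Metric.closedBall Y₀ d₀, ‖W‖ ≤ R := by
    intro W hW
    rw [Metric.mem_closedBall, dist_eq_norm] at hW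
    exact (norm_le_norm_add_norm_sub' W Y₀).trans (add_le_add le_rfl hW)
  have hrad : ∀ W ∈ Metric.closedBall Y₀ d₀, ∀ (s : ℝ) i,
      |(Xstar + s • ez + σ • W i) 1 - (Xstar + σ • Y₀ i) 1| ≤ σ * d₀ := by
    intro W hW s i
    rw [Metric.mem_closedBall, dist_eq_norm] at hW
    have h1 : (Xstar + s • ez + σ • W i) 1 - (Xstar + σ • Y₀ i) 1 = σ * (W i - Y₀ i) 1 := by
      simp
      ring
    rw [h1, abs_mul, abs_of_pos hσ]
    gcongr
    exact (abs_apply_le_norm _ _).trans ((norm_le_pi_norm (W - Y₀) i).trans hW)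
  have hvert : ∀ W ∈ Metric.closedBall Y₀ d₀, ∀ t ∈ Set.Icc 0 T, ∀ i,
      |(Xstar + (c * t) • ez + σ • W i) 0 - zstar| ≤ h₀ := by
    intro W hW t ht i
    have h1 : (Xstar + (c * t) • ez + σ • W i) 0 - zstar = c * t + σ * W i 0 := by
      simp [hp0]
      ring
    have h2 : |σ * W i 0| ≤ h₀ / 2 := by
      rw [abs_mul, abs_of_pos hσ]
      refine le_trans ?_ hσh
      gcongr
      exact (abs_apply_le_norm _ _).trans ((norm_le_pi_norm W i).trans (hball W hW))
    rw [h1]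
    exact (abs_add_le _ _).trans (by linarith [hcT t ht])
  refine ⟨fun t i => Xstar + (c * t) • ez + σ • Z t i, Y, ⟨?_, ?_⟩, ⟨?_, ?_⟩, ?_⟩
  · exact (isEpsSol_iff_isRescaledSol hr hσ hσL hp).2 hZ
  · intro X' hX' t ht
    have hform : X' = fun t i => Xstar + (c * t) • ez
        + σ • (σ⁻¹ • (X' t i - (Xstar + (c * t) • ez))) := by
      funext t i
      rw [smul_inv_smul₀ hσ.ne', add_sub_cancel]
    rw [hform] at hX' ⊢
    have heq := ((isEpsSol_iff_isRescaledSol hr hσ hσL hp).1 hX').eqOn hγ hr hZ ht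
    funext i
    simp only [← heq]
  · exact (isLimSol_iff_isRescaledSol hr).2 hY
  · exact fun Y' hY' t ht => ((isLimSol_iff_isRescaledSol hr).1 hY').eqOn hγ hr hY ht
  · intro t ht i
    refine ⟨hrad _ (hZmem t) _ i, hvert _ (hZmem t) t ht i, hrad _ (hYmem t) _ i,
      hvert _ (hYmem t) t ht i, ?_⟩
    have hdiff : Xstar + (c * t) • ez + σ • Z t i - (Xstar + (c * t) • ez + σ • Y t i)
        = σ • (Z t i - Y t i) := by
      rw [add_sub_add_left_eq_sub, smul_sub]
    have hclose := hZ.norm_sub_le hγ hr hσ.le hδ hY (fun t => hsubσ (hZmem t))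
      (fun t => hsub0 (hZmem t)) (fun t => hsub0 (hYmem t)) (fun t => hball _ (hZmem t)) ht
    rw [hdiff, norm_smul, Real.norm_eq_abs, abs_of_pos hσ]
    calc σ * ‖Z t i - Y t i‖ ≤ σ * (C * σ) := by
          gcongr
          exact (norm_le_pi_norm (Z t - Y t) i).trans hclose
      _ = C * σ ^ 2 := by ring
      _ = C / L := by rw [hσL, div_eq_mul_inv]
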